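/- Let f(X) = a_0 + a_1 X + ... + a_n X^n be a polynomial with integer coefficients of degree n ≥ 1, and let a, b be two integers such that a² < b² and |a_n| > Σ_{i=0}^{n-1} |a_i| · (|a+b|/2)^{i−n}. Suppose |f(a)| = p^u and |f(b)| = q^v·r^t for three distinct prime numbers p, q, r and positive integers u, v, t with p^u > q^v, p^u > r^t, p^u < q^v·r^t, p ∤ f'(a), q ∤ f'(b) and r ∤ f'(b). Then f is irreducible over ℚ. -/

import Mathlib

open Polynomial

/-- A root bound of Cauchy type: if the leading coefficient dominates the other coefficients
weighted by powers of `c`, then all complex roots have modulus less than `c`. -/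
theorem norm_lt_of_aeval_eq_zero (f : ℤ[X]) {c : ℝ} (hc : 0 < c)
    (hlead : ((|f.leadingCoeff| : ℤ) : ℝ) >
      ∑ i ∈ Finset.range f.natDegree,
        ((|f.coeff i| : ℤ) : ℝ) * c ^ ((i : ℤ) - (f.natDegree : ℤ)))
    {z : ℂ} (hz : aeval z f = 0) : ‖z‖ < c := by
  by_contra! hcz
  have hz0 : 0 < ‖z‖ := hc.trans_le hcz
  rw [aeval_eq_sum_range, Finset.sum_range_succ, add_eq_zero_iff_eq_neg'] at hz
  have hnorm (i : ℕ) : ‖f.coeff i • z ^ i‖ = ((|f.coeff i| : ℤ) : ℝ) * ‖z‖ ^ i := by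
    simp [zsmul_eq_mul]
  have hle : ((|f.leadingCoeff| : ℤ) : ℝ) * ‖z‖ ^ f.natDegree ≤
      ∑ i ∈ Finset.range f.natDegree, ((|f.coeff i| : ℤ) : ℝ) * ‖z‖ ^ i := by
    rw [leadingCoeff, ← hnorm, hz, norm_neg]
    exact (norm_sum_le _ _).trans_eq (Finset.sum_congr rfl fun i _ => hnorm i)
  refine hle.not_gt (lt_of_le_of_lt ?_ (mul_lt_mul_of_pos_right hlead (pow_pos hz0 f.natDegree)))
  rw [Finset.sum_mul]
  refine Finset.sum_le_sum fun i hi => ?_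
  rw [mul_assoc]
  refine mul_le_mul_of_nonneg_left ?_ (by positivity)
  have hexp : (i : ℤ) - f.natDegree = -((f.natDegree - i : ℕ) : ℤ) := by
    have := Finset.mem_range.1 hi
    omega
  calc ‖z‖ ^ i = ‖z‖ ^ ((i : ℤ) - f.natDegree) * ‖z‖ ^ f.natDegree := by
        rw [← zpow_natCast, ← zpow_natCast, ← zpow_add₀ hz0.ne', sub_add_cancel]
    _ ≤ c ^ ((i : ℤ) - f.natDegree) * ‖z‖ ^ f.natDegree := by
        rw [hexp, zpow_neg, zpow_neg, zpow_natCast, zpow_natCast]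
        gcongr

/-- If a nonconstant integer polynomial has all complex roots closer to `a` than to `b`, then its
absolute value at `a` is smaller than at `b`. -/
theorem natAbs_eval_lt_natAbs_eval {g : ℤ[X]} (hg : g.natDegree ≠ 0) {a b : ℤ}
    (hroots : ∀ z : ℂ, aeval z g = 0 → ‖(a : ℂ) - z‖ < ‖(b : ℂ) - z‖) :
    (g.eval a).natAbs < (g.eval b).natAbs := by
  have hg0 : g ≠ 0 := by rintro rfl; simp at hg
  set G : ℂ[X] := g.map (Int.castRingHom ℂ) with hG
  have hinj : Function.Injective (Int.castRingHom ℂ) := Int.cast_injective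
  have hsplit : G.Splits := IsAlgClosed.splits G
  have hG0 : G ≠ 0 := (Polynomial.map_ne_zero_iff hinj).2 hg0
  have heval (x : ℤ) : ‖((g.eval x : ℤ) : ℂ)‖ =
      ‖G.leadingCoeff‖ * (G.roots.map fun z => ‖(x : ℂ) - z‖).prod := by
    have h : ((g.eval x : ℤ) : ℂ) = G.eval (x : ℂ) := by
      rw [hG, ← eq_intCast (Int.castRingHom ℂ) x, eval_map_apply, eq_intCast]
    rw [h, hsplit.eval_eq_prod_roots, norm_mul]
    congr 1
    exact (map_multiset_prod (normHom : ℂ →*₀ ℝ) _).trans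
      (congrArg Multiset.prod (Multiset.map_map _ _ _))
  have hrootsne : G.roots ≠ 0 := by
    rw [← Multiset.card_pos, ← hsplit.natDegree_eq_card_roots, hG,
      natDegree_map_eq_of_injective hinj]
    omega
  have hprod : (G.roots.map fun z => ‖(a : ℂ) - z‖).prod <
      (G.roots.map fun z => ‖(b : ℂ) - z‖).prod := by
    have hmem : ∀ z ∈ G.roots, ‖(a : ℂ) - z‖ < ‖(b : ℂ) - z‖ := fun z hz => hroots z <| by
      have := (mem_roots hG0).1 hz
      rwa [IsRoot, hG, eval_map, ← algebraMap_int_eq, ← aeval_def] at this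
    generalize G.roots = s at hrootsne hmem
    induction s using Multiset.induction_on with
    | empty => exact absurd rfl hrootsne
    | cons w s ih =>
      rw [Multiset.map_cons, Multiset.map_cons, Multiset.prod_cons, Multiset.prod_cons]
      have hw := hmem w (Multiset.mem_cons_self w s)
      rcases eq_or_ne s 0 with rfl | hs
      · simpa using hw
      · exact mul_lt_mul'' hw (ih hs fun z hz => hmem z (Multiset.mem_cons_of_mem hz))
          (norm_nonneg _) (Multiset.prod_map_nonneg fun _ _ => norm_nonneg _)
  have hlt : ‖((g.eval a : ℤ) : ℂ)‖ < ‖((g.eval b : ℤ) : ℂ)‖ := by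
    rw [heval, heval]
    exact mul_lt_mul_of_pos_left hprod (norm_pos_iff.2 (leadingCoeff_ne_zero.2 hG0))
  rw [Complex.norm_intCast, Complex.norm_intCast] at hlt
  zify
  exact_mod_cast hlt

theorem norm_intCast_sub_lt {a b : ℤ} (hab : a ^ 2 < b ^ 2) {z : ℂ}
    (hz : ‖z‖ < ((|a + b| : ℤ) : ℝ) / 2) : ‖(a : ℂ) - z‖ < ‖(b : ℂ) - z‖ := by
  have hre := (Complex.abs_re_le_norm z).trans_lt hz
  have hab' : (a : ℝ) ^ 2 < (b : ℝ) ^ 2 := by exact_mod_cast hab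
  rw [← sq_lt_sq₀ (norm_nonneg _) (norm_nonneg _), Complex.sq_norm, Complex.sq_norm,
    Complex.normSq_apply, Complex.normSq_apply]
  simp only [Complex.sub_re, Complex.sub_im, Complex.intCast_re, Complex.intCast_im]
  push_cast at hre
  rw [abs_lt] at hre
  rcases abs_cases ((a : ℝ) + b) with ⟨h, h'⟩ | ⟨h, h'⟩ <;> rw [h] at hre
  · have : (a : ℝ) < b := by nlinarith
    nlinarith [hre.1, hre.2]
  · have : (b : ℝ) < a := by nlinarith
    nlinarith [hre.1, hre.2]

/-- A prime power dividing `(g * h)(x)` divides one of the two factors when the prime does not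
divide `(g * h)'(x)`. -/
theorem pow_dvd_natAbs_eval_or {g h : ℤ[X]} {x : ℤ} {p k : ℕ} (hp : p.Prime)
    (hd : ¬ (p : ℤ) ∣ (g * h).derivative.eval x)
    (hk : p ^ k ∣ (g.eval x).natAbs * (h.eval x).natAbs) :
    p ^ k ∣ (g.eval x).natAbs ∨ p ^ k ∣ (h.eval x).natAbs := by
  by_cases hg : p ∣ (g.eval x).natAbs
  · refine .inl (hp.prime.pow_dvd_of_dvd_mul_right k (fun hh => hd ?_) hk)
    rw [derivative_mul, eval_add, eval_mul, eval_mul]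
    exact dvd_add ((Int.natCast_dvd.2 hh).mul_left _) ((Int.natCast_dvd.2 hg).mul_right _)
  · exact .inr (hp.prime.pow_dvd_of_dvd_mul_left k hg hk)

theorem le_max_of_mul_eq_mul_of_coprime {x y m n : ℕ} (hmn : m.Coprime n) (hm : 0 < m)
    (hn : 0 < n) (hxy : x * y = m * n) (hx : 1 < x) (hxm : m ∣ x ∨ m ∣ y)
    (hxn : n ∣ x ∨ n ∣ y) : y ≤ max m n := by
  rcases hxm with ⟨k, rfl⟩ | hym
  · rw [mul_assoc] at hxy
    exact le_max_of_le_right (Nat.le_of_dvd hn ⟨k, by linarith [Nat.eq_of_mul_eq_mul_left hm hxy]⟩)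
  rcases hxn with ⟨k, rfl⟩ | hyn
  · rw [mul_comm m n, mul_assoc] at hxy
    exact le_max_of_le_left (Nat.le_of_dvd hm ⟨k, by linarith [Nat.eq_of_mul_eq_mul_left hn hxy]⟩)
  · have hpos : 0 < m * n := Nat.mul_pos hm hn
    have hy : 0 < y := Nat.pos_of_ne_zero (by rintro rfl; omega)
    have := Nat.le_of_dvd hy (hmn.mul_dvd_of_dvd_of_dvd hym hyn)
    nlinarith

/-- A nonconstant integer polynomial is irreducible over `ℚ` as soon as it is not a product of two
nonconstant integer polynomials. -/
theorem irreducible_map_rat_of_forall_ne_mul {f : ℤ[X]} (hf : f.natDegree ≠ 0)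
    (h : ∀ g k : ℤ[X], g.natDegree ≠ 0 → k.natDegree ≠ 0 → f ≠ g * k) :
    Irreducible (f.map (Int.castRingHom ℚ)) := by
  have hf0 : f ≠ 0 := by rintro rfl; simp at hf
  have hprim := f.isPrimitive_primPart
  have hunit {g : ℤ[X]} (hg : g ∣ f.primPart) (hdeg : g.natDegree = 0) : IsUnit g := by
    rw [eq_C_of_natDegree_eq_zero hdeg] at hg ⊢
    exact isUnit_C.2 (hprim _ hg)
  have hirr : Irreducible f.primPart := by
    refine ⟨fun hu => hf ?_, fun g k hgk => ?_⟩
    · rw [← natDegree_primPart, natDegree_eq_zero_of_isUnit hu]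
    · by_contra! hcon
      have hg : g.natDegree ≠ 0 := fun h0 => hcon.1 (hunit ⟨k, hgk⟩ h0)
      have hk : k.natDegree ≠ 0 := fun h0 => hcon.2 (hunit ⟨g, hgk.trans (mul_comm g k)⟩ h0)
      refine h (C f.content * g) k ?_ hk ?_
      · rwa [natDegree_C_mul (content_eq_zero_iff.not.2 hf0)]
      · rw [mul_assoc, ← hgk, ← eq_C_content_mul_primPart]
  rw [IsPrimitive.Int.irreducible_iff_irreducible_map_cast hprim] at hirr
  rw [f.eq_C_content_mul_primPart, Polynomial.map_mul, map_C]
  refine (irreducible_isUnit_mul (isUnit_C.2 (IsUnit.mk0 _ ?_))).2 hirr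
  simpa using content_eq_zero_iff.not.2 hf0

theorem statement_16 (f : Polynomial ℤ) (hdeg : 1 ≤ f.natDegree) (a b : ℤ)
    (hab : a ^ 2 < b ^ 2)
    (hlead : ((|f.leadingCoeff| : ℤ) : ℝ) >
      ∑ i ∈ Finset.range f.natDegree,
        ((|f.coeff i| : ℤ) : ℝ) * (((|a + b| : ℤ) : ℝ) / 2) ^ ((i : ℤ) - (f.natDegree : ℤ)))
    (p q r : ℕ) (hp : p.Prime) (hq : q.Prime) (hr : r.Prime)
    (hpq : p ≠ q) (hpr : p ≠ r) (hqr : q ≠ r)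
    (u v t : ℕ) (hu : 1 ≤ u) (hv : 1 ≤ v) (ht : 1 ≤ t)
    (h1 : (q : ℤ) ^ v < (p : ℤ) ^ u) (h2 : (r : ℤ) ^ t < (p : ℤ) ^ u)
    (h3 : (p : ℤ) ^ u < (q : ℤ) ^ v * (r : ℤ) ^ t)
    (hfa : |f.eval a| = (p : ℤ) ^ u)
    (hfb : |f.eval b| = (q : ℤ) ^ v * (r : ℤ) ^ t)
    (hpd : ¬ ((p : ℤ) ∣ f.derivative.eval a))
    (hqd : ¬ ((q : ℤ) ∣ f.derivative.eval b))
    (hrd : ¬ ((r : ℤ) ∣ f.derivative.eval b)) :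
    Irreducible (Polynomial.map (Int.castRingHom ℚ) f) := by
  set c : ℝ := ((|a + b| : ℤ) : ℝ) / 2
  have hc : 0 < c := by
    have : a + b ≠ 0 := fun h => by
      rw [eq_neg_of_add_eq_zero_left h, neg_sq] at hab
      exact hab.false
    have : 0 < ((|a + b| : ℤ) : ℝ) := by exact_mod_cast abs_pos.2 this
    positivity
  have hfa' : (f.eval a).natAbs = p ^ u := by zify; exact hfa
  have hfb' : (f.eval b).natAbs = q ^ v * r ^ t := by zify; exact hfb
  have hlt {g : ℤ[X]} (hgf : g ∣ f) (hg : g.natDegree ≠ 0) :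
      (g.eval a).natAbs < (g.eval b).natAbs :=
    natAbs_eval_lt_natAbs_eval hg fun z hz => norm_intCast_sub_lt hab <|
      norm_lt_of_aeval_eq_zero f hc hlead <| by
        obtain ⟨k, rfl⟩ := hgf
        rw [map_mul, hz, zero_mul]
  have hnot_dvd {g h : ℤ[X]} (hg : g.natDegree ≠ 0) (hh : h.natDegree ≠ 0) (hgh : f = g * h) :
      ¬ p ^ u ∣ (h.eval a).natAbs := fun hdvd => by
    have hga := hlt ⟨h, hgh⟩ hg
    have hha := hlt ⟨g, hgh.trans (mul_comm g h)⟩ hh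
    rw [hgh, eval_mul, Int.natAbs_mul] at hfa' hfb'
    rw [hgh] at hqd hrd
    have hne : (g.eval a).natAbs * (h.eval a).natAbs ≠ 0 := hfa' ▸ (pow_pos hp.pos u).ne'
    have hga0 := left_ne_zero_of_mul hne
    have hle := Nat.le_of_dvd (Nat.pos_of_ne_zero (right_ne_zero_of_mul hne)) hdvd
    have hmax := le_max_of_mul_eq_mul_of_coprime
      (((Nat.coprime_primes hq hr).2 hqr).pow v t) (pow_pos hq.pos v) (pow_pos hr.pos t) hfb'
      (by omega) (pow_dvd_natAbs_eval_or hq hqd (hfb' ▸ dvd_mul_right _ _))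
      (pow_dvd_natAbs_eval_or hr hrd (hfb' ▸ dvd_mul_left _ _))
    have hmax' : max (q ^ v) (r ^ t) < p ^ u :=
      max_lt (by exact_mod_cast h1) (by exact_mod_cast h2)
    omega
  refine irreducible_map_rat_of_forall_ne_mul (by omega) fun g h hg hh hgh => ?_
  have hdvd : p ^ u ∣ (g.eval a).natAbs * (h.eval a).natAbs := by
    rw [← Int.natAbs_mul, ← eval_mul, ← hgh, hfa']
  rcases pow_dvd_natAbs_eval_or hp (hgh ▸ hpd) hdvd with hd | hd
  · exact hnot_dvd hh hg (hgh.trans (mul_comm g h)) hd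
  · exact hnot_dvd hg hh hgh hd
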